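/- The monic quintic f has one pair of nonreal complex-conjugate double roots and one real simple root — i.e., there exist a real number b and a nonreal w ∈ ℂ with f(X) = (X−w)^2(X−conj(w))^2(X−b) over ℂ — if and only if D = 0, L1 = 0, L2 ≠ 0 and D2 < 0. -/

import Mathlib

open Polynomial

noncomputable section

def quinticL2 (p q r s : ℝ) : ℝ :=
  3*p^2*q^2 - 45*r^2 - 8*p^3*r + 40*q*s + 38*p*q*r - 16*p^2*s - 12*q^3

def quinticL1 (p q r s t : ℝ) : ℝ :=
  -264*p*r*s^2 - 12*p^3*q^2*t + 36*p*q*r^3 - 124*p*q^2*r*s + 28*p^3*q*r*s + 260*p*q*s*t - 132*p^2*q*r*t + 240*p*r^2*t + 234*q*r^2*s + 32*p^4*r*t + 48*p*q^3*t - 56*p^3*s*t - 80*q^2*r*t + 194*p^2*q*s^2 - 600*r*s*t - 6*p^2*q^3*s + 2*p^2*q^2*r^2 - 12*p^2*r^2*s - 54*r^4 + 320*s^3 - 8*q^3*r^2 - 8*p^3*r^3 + 250*q*t^2 - 176*q^2*s^2 + 24*q^4*s - 36*p^4*s^2 - 100*p^2*t^2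

def quinticD2 (p q r s t : ℝ) : ℝ :=
  24*p^2*q^4*s - 1100*q^3*r*t + 800*p^3*q*s*t - 1735*p^2*q^2*r*t - 3*p^2*q*r^2*s + 20*p*q^3*r*s - 600*p^2*r*s*t - 1150*p*q^2*s*t + 5475*p*q*r^2*t - 1380*p*q*r*s^2 + 1500*q*r*s*t + 6*p^3*q*r^3 + p^4*q^2*r^2 - 128*p^6*r*t + 660*p*q^4*t - 136*p^5*s*t - 3*p^4*q^3*s - 236*p^4*q*s^2 + 337*p^2*q^2*s^2 + 48*p^5*q^2*t - 357*p^3*q^3*t - 12*p^4*r^2*s - 45*p*r^3*s + 60*q^2*r^2*s - 8*p^2*q^3*r^2 - 500*p^2*q*t^2 - 24*p*q^2*r^3 - 1380*p^3*r^2*t + 408*p^3*r*s^2 - 4*p^5*q*r*s + 1028*p^4*q*r*t + 11*p^3*q^2*r*s + 36*p^6*s^2 + 100*p^4*t^2 + 9*p^2*r^4 - 48*q^5*s + 16*q^4*r^2 + 160*q^3*s^2 + 625*q^2*t^2 - 3375*r^3*t + 900*r^2*s^2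

theorem quintic_coeffs_eq {p q r s t p' q' r' s' t' : ℂ}
    (h : (X ^ 5 + C p * X ^ 4 + C q * X ^ 3 + C r * X ^ 2 + C s * X + C t : ℂ[X]) =
      X ^ 5 + C p' * X ^ 4 + C q' * X ^ 3 + C r' * X ^ 2 + C s' * X + C t') :
    p = p' ∧ q = q' ∧ r = r' ∧ s = s' ∧ t = t' := by
  have coeff_eq (n : ℕ) := congrArg (fun P : ℂ[X] => P.coeff n) h
  refine ⟨?_, ?_, ?_, ?_, ?_⟩
  · simpa [coeff_X, coeff_C] using coeff_eq 4
  · simpa [coeff_X, coeff_C] using coeff_eq 3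
  · simpa [coeff_X, coeff_C] using coeff_eq 2
  · simpa [coeff_X, coeff_C] using coeff_eq 1
  · simpa [coeff_X, coeff_C] using coeff_eq 0

/-- The Vieta formulas for a monic quintic written as a product of five linear factors. -/
theorem quintic_vieta {p q r s t a b c d e : ℂ}
    (h : (X ^ 5 + C p * X ^ 4 + C q * X ^ 3 + C r * X ^ 2 + C s * X + C t : ℂ[X]) =
      (X - C a) * (X - C b) * (X - C c) * (X - C d) * (X - C e)) :
    p = -(a + b + c + d + e) ∧
    q = a * b + a * c + a * d + a * e + b * c + b * d + b * e + c * d + c * e + d * e ∧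
    r = -(a * b * c + a * b * d + a * b * e + a * c * d + a * c * e + a * d * e + b * c * d +
      b * c * e + b * d * e + c * d * e) ∧
    s = a * b * c * d + a * b * c * e + a * b * d * e + a * c * d * e + b * c * d * e ∧
    t = -(a * b * c * d * e) := by
  have expand : (X - C a) * (X - C b) * (X - C c) * (X - C d) * (X - C e) =
      X ^ 5 + C (-(a + b + c + d + e)) * X ^ 4 +
      C (a * b + a * c + a * d + a * e + b * c + b * d + b * e + c * d + c * e + d * e) * X ^ 3 +
      C (-(a * b * c + a * b * d + a * b * e + a * c * d + a * c * e + a * d * e + b * c * d +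
        b * c * e + b * d * e + c * d * e)) * X ^ 2 +
      C (a * b * c * d + a * b * c * e + a * b * d * e + a * c * d * e + b * c * d * e) * X +
      C (-(a * b * c * d * e)) := by
    simp only [map_neg, map_add, map_mul]
    ring
  rw [expand] at h
  exact quintic_coeffs_eq h

/-- With a double root, `quinticL1` is twice the discriminant of the set of the other roots
together with that root. -/
theorem quinticL1_of_double_root {p q r s t : ℝ} {u a b c : ℂ}
    (h : (X ^ 5 + C (p : ℂ) * X ^ 4 + C (q : ℂ) * X ^ 3 + C (r : ℂ) * X ^ 2 + C (s : ℂ) * X +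
      C (t : ℂ) : ℂ[X]) = (X - C u) * (X - C u) * (X - C a) * (X - C b) * (X - C c)) :
    (quinticL1 p q r s t : ℂ) =
      2 * ((u - a) * (u - b) * (u - c) * (a - b) * (a - c) * (b - c)) ^ 2 := by
  obtain ⟨hp, hq, hr, hs, ht⟩ := quintic_vieta h
  simp only [quinticL1]
  push_cast
  rw [hp, hq, hr, hs, ht]
  ring

theorem quinticD2_of_triple_root {p q r s t : ℝ} {u a b : ℂ}
    (h : (X ^ 5 + C (p : ℂ) * X ^ 4 + C (q : ℂ) * X ^ 3 + C (r : ℂ) * X ^ 2 + C (s : ℂ) * X +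
      C (t : ℂ) : ℂ[X]) = (X - C u) * (X - C u) * (X - C u) * (X - C a) * (X - C b)) :
    quinticD2 p q r s t = 0 := by
  obtain ⟨hp, hq, hr, hs, ht⟩ := quintic_vieta h
  rw [← Complex.ofReal_eq_zero]
  simp only [quinticD2]
  push_cast
  rw [hp, hq, hr, hs, ht]
  ring

theorem quinticL2_of_two_double_roots {p q r s t : ℝ} {u v b : ℂ}
    (h : (X ^ 5 + C (p : ℂ) * X ^ 4 + C (q : ℂ) * X ^ 3 + C (r : ℂ) * X ^ 2 + C (s : ℂ) * X +
      C (t : ℂ) : ℂ[X]) = (X - C u) * (X - C u) * (X - C v) * (X - C v) * (X - C b)) :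
    (quinticL2 p q r s : ℂ) = 4 * ((u - v) * (u - b) * (v - b)) ^ 2 := by
  obtain ⟨hp, hq, hr, hs, ht⟩ := quintic_vieta h
  simp only [quinticL2]
  push_cast
  rw [hp, hq, hr, hs]
  ring

theorem quinticD2_of_two_double_roots {p q r s t : ℝ} {u v b : ℂ}
    (h : (X ^ 5 + C (p : ℂ) * X ^ 4 + C (q : ℂ) * X ^ 3 + C (r : ℂ) * X ^ 2 + C (s : ℂ) * X +
      C (t : ℂ) : ℂ[X]) = (X - C u) * (X - C u) * (X - C v) * (X - C v) * (X - C b)) :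
    (quinticD2 p q r s t : ℂ) = 4 * (u - v) ^ 6 * (u - b) ^ 4 * (v - b) ^ 4 := by
  obtain ⟨hp, hq, hr, hs, ht⟩ := quintic_vieta h
  simp only [quinticD2]
  push_cast
  rw [hp, hq, hr, hs, ht]
  ring

/-- A product over five indices with a repeated root, with the repeated factors in front. -/
theorem exists_prod_X_sub_C_eq_of_not_injective {z : Fin 5 → ℂ} {i j : Fin 5} (hij : i ≠ j)
    (hz : z i = z j) :
    ∃ u a b c : ℂ, ∏ k, (X - C (z k)) =
      (X - C u) * (X - C u) * (X - C a) * (X - C b) * (X - C c) := by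
  have hj : j ∈ Finset.univ.erase i := by simp [hij.symm]
  have hcard : ((Finset.univ.erase i).erase j).card = 3 := by
    rw [Finset.card_erase_of_mem hj, Finset.card_erase_of_mem (Finset.mem_univ i)]
    simp
  obtain ⟨k, l, m, hkl, hkm, hlm, he⟩ := Finset.card_eq_three.mp hcard
  refine ⟨z i, z k, z l, z m, ?_⟩
  rw [← Finset.mul_prod_erase _ _ (Finset.mem_univ i), ← Finset.mul_prod_erase _ _ hj, he,
    Finset.prod_insert (by simp [hkl, hkm]), Finset.prod_insert (by simp [hlm]),
    Finset.prod_singleton, ← hz]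
  ring

theorem not_injective_of_sq_dvd_prod_X_sub_C {z : Fin 5 → ℂ} {w : ℂ}
    (h : (X - C w) ^ 2 ∣ ∏ k, (X - C (z k))) : ¬ Function.Injective z := by
  intro hz
  have hsq := ((separable_prod_X_sub_C_iff (f := z)).mpr hz).squarefree
  exact not_isUnit_X_sub_C w (hsq (X - C w) (by rwa [← sq]))

theorem prod_sub_sq_eq_zero_iff (z : Fin 5 → ℂ) :
    ∏ i : Fin 5, ∏ j ∈ Finset.Ioi i, (z i - z j) ^ 2 = 0 ↔ ¬ Function.Injective z := by
  simp only [Finset.prod_eq_zero_iff, Finset.mem_univ, true_and, Finset.mem_Ioi,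
    pow_eq_zero_iff two_ne_zero, sub_eq_zero, Function.not_injective_iff]
  constructor
  · rintro ⟨i, j, hij, h⟩
    exact ⟨i, j, h, hij.ne⟩
  · rintro ⟨i, j, h, hij⟩
    rcases lt_or_gt_of_ne hij with hlt | hlt
    · exact ⟨i, j, hlt, h⟩
    · exact ⟨j, i, hlt, h.symm⟩

/-- The roots of a real quintic with two double roots and one simple root, all distinct: the
simple root is real, and the double roots are either both real or conjugate to each other. -/
theorem conj_two_double_roots {p q r s t : ℝ} {u v b : ℂ} (huv : u ≠ v) (hub : u ≠ b)
    (hvb : v ≠ b)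
    (h : (X ^ 5 + C (p : ℂ) * X ^ 4 + C (q : ℂ) * X ^ 3 + C (r : ℂ) * X ^ 2 + C (s : ℂ) * X +
      C (t : ℂ) : ℂ[X]) = (X - C u) * (X - C u) * (X - C v) * (X - C v) * (X - C b)) :
    starRingEnd ℂ b = b ∧
      (starRingEnd ℂ u = u ∧ starRingEnd ℂ v = v ∨ starRingEnd ℂ u = v) := by
  have hstar : (X - C u) * (X - C u) * (X - C v) * (X - C v) * (X - C b) =
      (X - C (starRingEnd ℂ u)) * (X - C (starRingEnd ℂ u)) * (X - C (starRingEnd ℂ v)) *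
        (X - C (starRingEnd ℂ v)) * (X - C (starRingEnd ℂ b)) := by
    rw [← h]
    simpa [Polynomial.map_mul] using congrArg (Polynomial.map (starRingEnd ℂ)) h
  have hmul : ({u, u, v, v, b} : Multiset ℂ) =
      {starRingEnd ℂ u, starRingEnd ℂ u, starRingEnd ℂ v, starRingEnd ℂ v, starRingEnd ℂ b} := by
    have h1 := congrArg Polynomial.roots
      (show (Multiset.map (fun a => X - C a) ({u, u, v, v, b} : Multiset ℂ)).prod =
        (Multiset.map (fun a => X - C a) ({starRingEnd ℂ u, starRingEnd ℂ u, starRingEnd ℂ v,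
          starRingEnd ℂ v, starRingEnd ℂ b} : Multiset ℂ)).prod by
        simpa [mul_assoc] using hstar)
    rwa [roots_multiset_prod_X_sub_C, roots_multiset_prod_X_sub_C] at h1
  have hcount (x : ℂ) := congrArg (Multiset.count x) hmul
  have hinj := (starRingEnd ℂ).injective
  have huv' := hinj.ne huv
  have hub' := hinj.ne hub
  have hvb' := hinj.ne hvb
  have hb := hcount b
  have hu := hcount u
  have hv := hcount v
  simp only [Multiset.insert_eq_cons, Multiset.count_cons, Multiset.count_singleton] at hb hu hv
  clear hcount hmul hstar h hinj
  generalize starRingEnd ℂ u = u' at *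
  generalize starRingEnd ℂ v = v' at *
  generalize starRingEnd ℂ b = b' at *
  grind

theorem quintic_conj_pair_doubles_one_single (p q r s t D : ℝ) (z : Fin 5 → ℂ)
    (hf : (X ^ 5 + C (p : ℂ) * X ^ 4 + C (q : ℂ) * X ^ 3 + C (r : ℂ) * X ^ 2 + C (s : ℂ) * X + C (t : ℂ) : Polynomial ℂ) = ∏ i : Fin 5, (X - C (z i)))
    (hD : (D : ℂ) = ∏ i : Fin 5, ∏ j ∈ Finset.Ioi i, (z i - z j) ^ 2) :
    (∃ (b : ℝ) (w : ℂ), w.im ≠ 0 ∧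
      (X ^ 5 + C (p : ℂ) * X ^ 4 + C (q : ℂ) * X ^ 3 + C (r : ℂ) * X ^ 2 + C (s : ℂ) * X + C (t : ℂ) : Polynomial ℂ) =
        (X - C w) ^ 2 * (X - C ((starRingEnd ℂ) w)) ^ 2 * (X - C (b : ℂ))) ↔
    (D = 0 ∧ quinticL1 p q r s t = 0 ∧ quinticL2 p q r s ≠ 0 ∧ quinticD2 p q r s t < 0) := by
  have hdisc : D = 0 ↔ ¬ Function.Injective z := by
    rw [← prod_sub_sq_eq_zero_iff, ← hD, Complex.ofReal_eq_zero]
  constructor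
  · rintro ⟨b, w, hw, hfw⟩
    have h : (X ^ 5 + C (p : ℂ) * X ^ 4 + C (q : ℂ) * X ^ 3 + C (r : ℂ) * X ^ 2 + C (s : ℂ) * X +
        C (t : ℂ) : ℂ[X]) = (X - C w) * (X - C w) * (X - C (starRingEnd ℂ w)) *
          (X - C (starRingEnd ℂ w)) * (X - C (b : ℂ)) := by
      rw [hfw]
      ring
    have hsub : w - starRingEnd ℂ w = ((2 * w.im : ℝ) : ℂ) * Complex.I := by
      rw [Complex.sub_conj]
    have hmul : (w - b) * (starRingEnd ℂ w - b) = (Complex.normSq (w - b) : ℂ) := by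
      rw [← Complex.mul_conj]
      simp
    have hnorm : 0 < Complex.normSq (w - b) := by
      rw [Complex.normSq_pos, sub_ne_zero]
      rintro rfl
      simp at hw
    have hL2 : quinticL2 p q r s = -(16 * w.im ^ 2 * Complex.normSq (w - b) ^ 2) := by
      apply Complex.ofReal_injective
      rw [quinticL2_of_two_double_roots h, mul_assoc, hsub, hmul]
      push_cast
      linear_combination (16 * (w.im : ℂ) ^ 2 * (Complex.normSq (w - b) : ℂ) ^ 2) * Complex.I_sq
    have hD2 : quinticD2 p q r s t = -(256 * w.im ^ 6 * Complex.normSq (w - b) ^ 4) := by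
      apply Complex.ofReal_injective
      rw [quinticD2_of_two_double_roots h, mul_assoc, ← mul_pow, hsub, hmul, mul_pow _ _ 6,
        show Complex.I ^ 6 = -1 by rw [show 6 = 2 * 3 from rfl, pow_mul, Complex.I_sq]; norm_num]
      push_cast
      ring
    refine ⟨hdisc.mpr (not_injective_of_sq_dvd_prod_X_sub_C (w := w) ?_), ?_, ?_, ?_⟩
    · rw [← hf, hfw, mul_assoc]
      exact dvd_mul_right _ _
    · rw [← Complex.ofReal_eq_zero, quinticL1_of_double_root h]
      ring
    · rw [hL2]
      have : w.im ^ 2 ≠ 0 := pow_ne_zero 2 hw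
      exact neg_ne_zero.mpr (by positivity)
    · rw [hD2, neg_lt_zero]
      have : 0 < w.im ^ 6 := Even.pow_pos (by decide) hw
      positivity
  · rintro ⟨hD0, hL1, hL2, hD2⟩
    obtain ⟨i, j, hz, hij⟩ := Function.not_injective_iff.mp (hdisc.mp hD0)
    obtain ⟨u, a, b, c, hprod⟩ := exists_prod_X_sub_C_eq_of_not_injective hij hz
    rw [hprod] at hf
    have two_double_roots : ∃ u v b : ℂ, (X ^ 5 + C (p : ℂ) * X ^ 4 + C (q : ℂ) * X ^ 3 +
        C (r : ℂ) * X ^ 2 + C (s : ℂ) * X + C (t : ℂ) : ℂ[X]) =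
          (X - C u) * (X - C u) * (X - C v) * (X - C v) * (X - C b) := by
      have hzero := quinticL1_of_double_root hf
      rw [hL1, Complex.ofReal_zero, eq_comm] at hzero
      simp only [mul_eq_zero, OfNat.ofNat_ne_zero, false_or, pow_eq_zero_iff, ne_eq,
        not_false_eq_true, sub_eq_zero] at hzero
      rcases hzero with ((((rfl | rfl) | rfl) | rfl) | rfl) | rfl
      · exact absurd (quinticD2_of_triple_root hf) hD2.ne
      · exact absurd (quinticD2_of_triple_root (u := u) (a := a) (b := c) (by rw [hf]; ring)) hD2.ne
      · exact absurd (quinticD2_of_triple_root (u := u) (a := a) (b := b) (by rw [hf]; ring)) hD2.ne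
      · exact ⟨u, a, c, hf⟩
      · exact ⟨u, a, b, by rw [hf]; ring⟩
      · exact ⟨u, b, a, by rw [hf]; ring⟩
    obtain ⟨u, v, b, h⟩ := two_double_roots
    have hne : ((u - v) * (u - b) * (v - b)) ≠ 0 := by
      intro h0
      apply hL2
      rw [← Complex.ofReal_eq_zero, quinticL2_of_two_double_roots h, h0]
      ring
    simp only [ne_eq, mul_eq_zero, not_or, sub_eq_zero] at hne
    obtain ⟨⟨huv, hub⟩, hvb⟩ := hne
    obtain ⟨hb, ⟨hu, hv⟩ | hw⟩ := conj_two_double_roots huv hub hvb h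
    · obtain ⟨b, rfl⟩ := Complex.conj_eq_iff_real.mp hb
      obtain ⟨u, rfl⟩ := Complex.conj_eq_iff_real.mp hu
      obtain ⟨v, rfl⟩ := Complex.conj_eq_iff_real.mp hv
      have heq : quinticD2 p q r s t = 4 * (u - v) ^ 6 * (u - b) ^ 4 * (v - b) ^ 4 := by
        exact_mod_cast quinticD2_of_two_double_roots h
      have : 0 ≤ 4 * (u - v) ^ 6 * (u - b) ^ 4 * (v - b) ^ 4 := by
        have := Even.pow_nonneg (show Even 6 by decide) (u - v)
        positivity
      exact absurd hD2 (by rw [heq]; exact this.not_gt)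
    · obtain ⟨b, rfl⟩ := Complex.conj_eq_iff_real.mp hb
      refine ⟨b, u, fun him => huv ?_, by rw [h, hw]; ring⟩
      rw [← hw, Complex.conj_eq_iff_im.mpr him]
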